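/- Let R1 and R2 be relations over attribute sets U1 and U2, F and G filters over U1 ∪ U2, and w an attribute in U2 ∖ U1. If F ∧ G ≡⁺ ⊥ (i.e., F ∧ G never evaluates to ⊤), then σ_G(R1 ⟕_F σ_{¬isNull(w)} R2) ≡ σ_{isNull(w) ∧ nullify_{U2∖U1}(G)}(R1 ⟕_F σ_{¬isNull(w)} R2). -/

import Mathlib

noncomputable section
open Classical

attribute [local instance 10] Classical.propDecidable

namespace RA

variable {A Δ : Type} [DecidableEq A] [DecidableEq Δ]

/-- Three-valued logic: true, false, unknown (error). -/
inductive TV where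
  | tt | ff | unk
deriving DecidableEq

/-- Kleene conjunction. -/
def TV.and : TV → TV → TV
  | .ff, _ => .ff
  | _, .ff => .ff
  | .tt, .tt => .tt
  | _, _ => .unk

/-- Kleene negation. -/
def TV.not : TV → TV
  | .tt => .ff
  | .ff => .tt
  | .unk => .unk

mutual
/-- Terms over attributes `A` and domain `Δ`: attributes, constants and conditionals. -/
inductive Term (A Δ : Type) where
  | attr : A → Term A Δ
  | const : Δ → Term A Δ
  | ite : Filter A Δ → Term A Δ → Term A Δ → Term A Δ

/-- RA filters: `isNull` on a (finite) set of terms, equality, conjunction, negation. -/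
inductive Filter (A Δ : Type) where
  | isNull : List (Term A Δ) → Filter A Δ
  | eq : Term A Δ → Term A Δ → Filter A Δ
  | and : Filter A Δ → Filter A Δ → Filter A Δ
  | not : Filter A Δ → Filter A Δ
end

/-- Disjunction: `F1 ∨ F2 = ¬(¬F1 ∧ ¬F2)`. -/
def Filter.or (F1 F2 : Filter A Δ) : Filter A Δ := .not ((Filter.not F1).and (Filter.not F2))

/-- The tautological filter ⊤ (`isNull` of the empty set of terms is always true). -/
def Filter.tru : Filter A Δ := .isNull []

/-- A tuple over a set of attributes: `none` marks attributes outside the set. -/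
abbrev Tuple (A Δ : Type) := A → Option Δ

mutual
/-- Evaluation of a term on a tuple (`null` is the distinguished null value of `Δ`). -/
def Term.eval (null : Δ) (t : Tuple A Δ) : Term A Δ → Δ
  | .attr a => (t a).getD null
  | .const c => c
  | .ite F v v' => if F.eval null t = TV.tt then v.eval null t else v'.eval null t

def Term.evalList (null : Δ) (t : Tuple A Δ) : List (Term A Δ) → List Δ
  | [] => []
  | v :: vs => v.eval null t :: Term.evalList null t vs

/-- Three-valued evaluation of a filter on a tuple. -/
def Filter.eval (null : Δ) (t : Tuple A Δ) : Filter A Δ → TV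
  | .isNull V => if ∀ d ∈ Term.evalList null t V, d = null then .tt else .ff
  | .eq v v' =>
      if v.eval null t = null ∨ v'.eval null t = null then .unk
      else if v.eval null t = v'.eval null t then .tt else .ff
  | .and F1 F2 => (F1.eval null t).and (F2.eval null t)
  | .not F => (F.eval null t).not
end

mutual
/-- Attributes occurring in a term. -/
def Term.attrs : Term A Δ → Finset A
  | .attr a => {a}
  | .const _ => ∅
  | .ite F v v' => F.attrs ∪ v.attrs ∪ v'.attrs

def Term.attrsList : List (Term A Δ) → Finset A
  | [] => ∅
  | v :: vs => v.attrs ∪ Term.attrsList vs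

/-- Attributes occurring in a filter. -/
def Filter.attrs : Filter A Δ → Finset A
  | .isNull V => Term.attrsList V
  | .eq v v' => v.attrs ∪ v'.attrs
  | .and F1 F2 => F1.attrs ∪ F2.attrs
  | .not F => F.attrs
end

/-- A term is over `U` if all its attributes are in `U`. -/
def Term.over (v : Term A Δ) (U : Finset A) : Prop := v.attrs ⊆ U

/-- A filter is over `U` if all its attributes are in `U`. -/
def Filter.over (F : Filter A Δ) (U : Finset A) : Prop := F.attrs ⊆ U

/-- A tuple is over `U` if its domain is exactly `U`. -/
def Tuple.isOver (t : Tuple A Δ) (U : Finset A) : Prop := ∀ a, (t a).isSome ↔ a ∈ U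

/-- A relation is a bag (multiset) of tuples. -/
abbrev Rel (A Δ : Type) := Multiset (Tuple A Δ)

/-- A relation is over `U` if all its tuples are. -/
def Rel.isOver (R : Rel A Δ) (U : Finset A) : Prop := ∀ t ∈ R, t.isOver U

/-- Selection σ_F. -/
def select (null : Δ) (F : Filter A Δ) (R : Rel A Δ) : Rel A Δ :=
  R.filter (fun t => F.eval null t = .tt)

/-- Restriction of a tuple to the attributes in `U`. -/
def Tuple.restrict (t : Tuple A Δ) (U : Finset A) : Tuple A Δ :=
  fun a => if a ∈ U then t a else none

/-- Projection π_U (bag semantics: multiplicities are added up). -/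
def proj (U : Finset A) (R : Rel A Δ) : Rel A Δ := R.map (·.restrict U)

/-- Bag difference: `(R1 ∖ R2)(t) = R1(t)` if `t ∉ R2` and `0` otherwise. -/
def bdiff (R1 R2 : Rel A Δ) : Rel A Δ := R1.filter (fun t => t ∉ R2)

/-- Compatibility of tuples: equal and non-null on the shared attributes. -/
def Compat (null : Δ) (t1 t2 : Tuple A Δ) : Prop :=
  ∀ a, (t1 a).isSome → (t2 a).isSome → (t1 a = t2 a ∧ t1 a ≠ some null)

/-- `t1 ⊕ t2`: the common extension of two (compatible) tuples. -/
def Tuple.merge (t1 t2 : Tuple A Δ) : Tuple A Δ :=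
  fun a => (t1 a).or (t2 a)

/-- Natural join. -/
def join (null : Δ) (R1 R2 : Rel A Δ) : Rel A Δ :=
  (R1.product R2).filterMap
    (fun p => if Compat null p.1 p.2 then some (p.1.merge p.2) else none)

/-- Natural join with a filter: `R1 ⋈_F R2 = σ_F (R1 ⋈ R2)`. -/
def joinF (null : Δ) (F : Filter A Δ) (R1 R2 : Rel A Δ) : Rel A Δ :=
  select null F (join null R1 R2)

/-- Padding of a tuple with `null` on the attributes of `V`. -/
def Tuple.pad (null : Δ) (V : Finset A) (t : Tuple A Δ) : Tuple A Δ :=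
  fun a => if a ∈ V then (t a).or (some null) else t a

/-- Outer union of `R1` over `U1` and `R2` over `U2`:
each relation is padded with nulls on the attributes missing from it. -/
def ounion (null : Δ) (U1 U2 : Finset A) (R1 R2 : Rel A Δ) : Rel A Δ :=
  R1.map (Tuple.pad null (U2 \ U1)) + R2.map (Tuple.pad null (U1 \ U2))

/-- Left join `R1 ⟕_F R2 = (R1 ⋈_F R2) ⊎ (R1 ∖ π_{U1}(R1 ⋈_F R2))`
for `R1` over `U1` and `R2` over `U2`. -/
def ljoin (null : Δ) (U1 U2 : Finset A) (F : Filter A Δ) (R1 R2 : Rel A Δ) : Rel A Δ :=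
  ounion null (U1 ∪ U2) U1 (joinF null F R1 R2) (bdiff R1 (proj U1 (joinF null F R1 R2)))

/-- Natural left join `R1 ⟕ R2 = R1 ⟕_⊤ R2`. -/
def nljoin (null : Δ) (U1 U2 : Finset A) (R1 R2 : Rel A Δ) : Rel A Δ :=
  ljoin null U1 U2 Filter.tru R1 R2

/-- Extension ν_{u↦v}. -/
def extend (null : Δ) (u : A) (v : Term A Δ) (R : Rel A Δ) : Rel A Δ :=
  R.map (fun t a => if a = u then some (v.eval null t) else t a)

/-- Duplicate elimination δ. -/
def dedup (R : Rel A Δ) : Rel A Δ := R.dedup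

/-- Extended renaming ρ^V_{{u/f(u) | u ∈ S}} at the level of tuples:
each attribute `u ∈ S` receives the value of the term `f u` (evaluated on the original
tuple) and the attributes of `V ∖ S` are projected away. -/
def renameFun (null : Δ) (V S : Finset A) (f : A → Term A Δ) (t : Tuple A Δ) : Tuple A Δ :=
  fun a => if a ∈ S then some ((f a).eval null t) else if a ∈ V then none else t a

/-- Extended renaming ρ^V_{{u/f(u) | u ∈ S}}. -/
def rename (null : Δ) (V S : Finset A) (f : A → Term A Δ) (R : Rel A Δ) : Rel A Δ :=
  R.map (renameFun null V S f)

/-- Renaming of the attribute `uold` into `unew` at the level of tuples. -/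
def renameAttrT (unew uold : A) (t : Tuple A Δ) : Tuple A Δ :=
  fun a => if a = unew then t uold else if a = uold then none else t a

/-- `R[unew/uold]`: the relation `R` with the attribute `uold` renamed to `unew`. -/
def renameAttr (unew uold : A) (R : Rel A Δ) : Rel A Δ := R.map (renameAttrT unew uold)

/-- `coalesce(v, v') = if(¬isNull(v), v, v')`. -/
def Term.coalesce (v v' : Term A Δ) : Term A Δ := .ite (.not (.isNull [v])) v v'

/-- The filter `⋀_{u ∈ K} ¬isNull(u)`. -/
def notNullAll (K : Finset A) : Filter A Δ :=
  K.toList.foldr (fun u acc => (Filter.not (.isNull [.attr u])).and acc) Filter.tru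

mutual
/-- `nullify_S`: replace every occurrence of an attribute from `S` by the constant null. -/
def Term.nullify (null : Δ) (S : Finset A) : Term A Δ → Term A Δ
  | .attr a => if a ∈ S then .const null else .attr a
  | .const c => .const c
  | .ite F v v' => .ite (F.nullify null S) (v.nullify null S) (v'.nullify null S)

def Term.nullifyList (null : Δ) (S : Finset A) : List (Term A Δ) → List (Term A Δ)
  | [] => []
  | v :: vs => v.nullify null S :: Term.nullifyList null S vs

/-- `nullify_S` on filters. -/
def Filter.nullify (null : Δ) (S : Finset A) : Filter A Δ → Filter A Δ
  | .isNull V => .isNull (Term.nullifyList null S V)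
  | .eq v v' => .eq (v.nullify null S) (v'.nullify null S)
  | .and F1 F2 => .and (F1.nullify null S) (F2.nullify null S)
  | .not F => .not (F.nullify null S)
end

/-- p-equivalence of filters over `U`: they are ⊤ on the same tuples over `U`. -/
def pequiv (null : Δ) (U : Finset A) (F1 F2 : Filter A Δ) : Prop :=
  ∀ t : Tuple A Δ, t.isOver U → (F1.eval null t = TV.tt ↔ F2.eval null t = TV.tt)

end RA

namespace RA

variable {A Δ : Type} [DecidableEq A] [DecidableEq Δ]

mutual
theorem Term.eval_nullify (null : Δ) (S : Finset A) (t : Tuple A Δ)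
    (h : ∀ a ∈ S, (t a).getD null = null) :
    ∀ v : Term A Δ, (v.nullify null S).eval null t = v.eval null t
  | .attr a => by
      by_cases ha : a ∈ S
      · simp [Term.nullify, Term.eval, ha, h a ha]
      · simp [Term.nullify, Term.eval, ha]
  | .const c => by simp [Term.nullify, Term.eval]
  | .ite F v v' => by
      simp only [Term.nullify, Term.eval, Filter.eval_nullify null S t h F,
        Term.eval_nullify null S t h v, Term.eval_nullify null S t h v']

theorem Term.evalList_nullifyList (null : Δ) (S : Finset A) (t : Tuple A Δ)
    (h : ∀ a ∈ S, (t a).getD null = null) :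
    ∀ V : List (Term A Δ),
      Term.evalList null t (Term.nullifyList null S V) = Term.evalList null t V
  | [] => by simp [Term.nullifyList]
  | v :: vs => by
      simp only [Term.nullifyList, Term.evalList, Term.eval_nullify null S t h v,
        Term.evalList_nullifyList null S t h vs]

/-- Nullifying attributes on which the tuple is already null does not change a filter's value. -/
theorem Filter.eval_nullify (null : Δ) (S : Finset A) (t : Tuple A Δ)
    (h : ∀ a ∈ S, (t a).getD null = null) :
    ∀ F : Filter A Δ, (F.nullify null S).eval null t = F.eval null t
  | .isNull V => by
      simp only [Filter.nullify, Filter.eval, Term.evalList_nullifyList null S t h V]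
  | .eq v v' => by
      simp only [Filter.nullify, Filter.eval, Term.eval_nullify null S t h v,
        Term.eval_nullify null S t h v']
  | .and F1 F2 => by
      simp only [Filter.nullify, Filter.eval, Filter.eval_nullify null S t h F1,
        Filter.eval_nullify null S t h F2]
  | .not F => by
      simp only [Filter.nullify, Filter.eval, Filter.eval_nullify null S t h F]
end

theorem TV.and_eq_tt {x y : TV} : x.and y = .tt ↔ x = .tt ∧ y = .tt := by
  cases x <;> cases y <;> simp [TV.and]

theorem Filter.eval_isNull_attr (null : Δ) (t : Tuple A Δ) (w : A) :
    (Filter.isNull [.attr w]).eval null t = .tt ↔ (t w).getD null = null := by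
  simp [Filter.eval, Term.evalList, Term.eval]

theorem Filter.eval_not_isNull_attr (null : Δ) (t : Tuple A Δ) (w : A) :
    (Filter.not (.isNull [.attr w])).eval null t = .tt ↔ (t w).getD null ≠ null := by
  by_cases h : (t w).getD null = null <;>
    simp [Filter.eval, Term.evalList, Term.eval, TV.not, h]

theorem mem_join {null : Δ} {R1 R2 : Rel A Δ} {t : Tuple A Δ} :
    t ∈ join null R1 R2 ↔
      ∃ t1 ∈ R1, ∃ t2 ∈ R2, Compat null t1 t2 ∧ t1.merge t2 = t := by
  simp only [join, Multiset.mem_filterMap]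
  constructor
  · rintro ⟨⟨t1, t2⟩, hp, h⟩
    obtain ⟨h1, h2⟩ := Multiset.mem_product.1 hp
    split_ifs at h with hc
    exact ⟨t1, h1, t2, h2, hc, Option.some.inj h⟩
  · rintro ⟨t1, h1, t2, h2, hc, h⟩
    exact ⟨(t1, t2), Multiset.mem_product.2 ⟨h1, h2⟩, by simp [hc, h]⟩

theorem Tuple.isOver.merge {t1 t2 : Tuple A Δ} {U1 U2 : Finset A}
    (h1 : t1.isOver U1) (h2 : t2.isOver U2) : (t1.merge t2).isOver (U1 ∪ U2) := fun a => by
  simp [Tuple.merge, h1 a, h2 a]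

theorem Tuple.isOver.eq_none {t : Tuple A Δ} {U : Finset A} (h : t.isOver U) {a : A}
    (ha : a ∉ U) : t a = none := by
  simpa using (h a).not.2 ha

theorem Tuple.pad_empty (null : Δ) (t : Tuple A Δ) : t.pad null ∅ = t := by
  funext a
  simp [Tuple.pad]

theorem stmt17 (null : Δ) (U1 U2 : Finset A) (R1 R2 : Rel A Δ) (F G : Filter A Δ) (w : A)
    (hR1 : R1.isOver U1) (hR2 : R2.isOver U2)
    (hF : F.over (U1 ∪ U2)) (hG : G.over (U1 ∪ U2)) (hw : w ∈ U2 \ U1)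
    (hbot : ∀ t : Tuple A Δ, t.isOver (U1 ∪ U2) → (F.and G).eval null t ≠ TV.tt) :
    select null G (ljoin null U1 U2 F R1 (select null (.not (.isNull [.attr w])) R2))
      = select null ((Filter.isNull [.attr w]).and (G.nullify null (U2 \ U1)))
          (ljoin null U1 U2 F R1 (select null (.not (.isNull [.attr w])) R2)) := by
  refine Multiset.filter_congr fun t ht => ?_
  obtain ⟨hw2, hw1⟩ := Finset.mem_sdiff.1 hw
  simp only [ljoin, ounion, Multiset.mem_add, Multiset.mem_map] at ht
  rw [Filter.eval, TV.and_eq_tt, Filter.eval_isNull_attr]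
  rcases ht with ⟨s, hs, rfl⟩ | ⟨s, hs, rfl⟩
  · rw [Finset.sdiff_eq_empty_iff_subset.2 Finset.subset_union_left, Tuple.pad_empty]
    obtain ⟨hs, hFs⟩ := Multiset.mem_filter.1 hs
    obtain ⟨t1, h1, t2, h2, -, rfl⟩ := mem_join.1 hs
    obtain ⟨h2, hwn⟩ := Multiset.mem_filter.1 h2
    rw [Filter.eval_not_isNull_attr] at hwn
    have hGs : G.eval null (t1.merge t2) ≠ .tt := fun hGs =>
      hbot _ ((hR1 t1 h1).merge (hR2 t2 h2)) (by rw [Filter.eval, TV.and_eq_tt]; exact ⟨hFs, hGs⟩)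
    have hws : ((t1.merge t2) w).getD null ≠ null := by
      simpa [Tuple.merge, (hR1 t1 h1).eq_none hw1] using hwn
    exact ⟨fun h => absurd h hGs, fun h => absurd h.1 hws⟩
  · have hs := hR1 s (Multiset.mem_filter.1 hs).1
    have hnull : ∀ a ∈ U2 \ U1, ((s.pad null ((U1 ∪ U2) \ U1)) a).getD null = null := by
      intro a ha
      obtain ⟨ha2, ha1⟩ := Finset.mem_sdiff.1 ha
      simp [Tuple.pad, ha1, ha2, hs.eq_none ha1]
    rw [Filter.eval_nullify null _ _ hnull]
    exact ⟨fun h => ⟨hnull w hw, h⟩, And.right⟩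

end RA
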